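/- arXiv:1101.4373 — 2 statements merged into one kernel-verified Lean document; each statement's English description precedes it below -/
import Mathlib

section
/- Convergence of the approximate alternating direction method of multipliers (Proposition A.2): under the stated setting, assume L_λ has a saddle point (û, v̂, p̂), assume that for all a, b ∈ ℝ the set {u ∈ U : ‖K u‖ ≤ a and J(u) ≤ b} is bounded, and let (u_k, v_k, p_k)_{k≥0} be an approximate ADMM sequence whose tolerances satisfy Σ_{k≥1} δ_k < ∞ and Σ_{k≥1} ε_k < ∞. Then the sequence (u_k, v_k)_{k≥1} is bounded in U × H, Σ_{k≥1} (‖K u_k + v_k − Y‖² + ‖K(u_k − u_{k−1})‖²) < ∞, and every weak cluster point is a solution of the linearly constrained problem: whenever φ : ℕ → ℕ is strictly increasing, u_{φ(k)} converges weakly to ũ in U and v_{φ(k)} converges to ṽ in H, then ṽ ∈ C, K ũ + ṽ = Y, and J(ũ) ≤ J(u) for every u ∈ U with Y − K u ∈ C. -/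
open RealInnerProductSpace

/-- The augmented Lagrangian `L_λ(u,v;p)`. -/
noncomputable def augLag {U H : Type*}
    [NormedAddCommGroup H] [InnerProductSpace ℝ H]
    [NormedAddCommGroup U] [InnerProductSpace ℝ U]
    (K : U →L[ℝ] H) (J : U → ℝ) (Y : H) (lam : ℝ) (u : U) (v p : H) : ℝ :=
  (1 / (2 * lam)) * ‖K u + v - Y‖ ^ 2 + J u - ⟪p, K u + v - Y⟫

section Auxiliary

/-- A nonnegative sequence that decreases by `d` up to a summable error is bounded, and the
decrements are summable. -/
lemma summable_and_bounded_of_quasi_descent {E d e : ℕ → ℝ} (hE : ∀ k, 0 ≤ E k)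
    (hd : ∀ k, 0 ≤ d k) (he : ∀ k, 0 ≤ e k) (hsum : Summable e)
    (h : ∀ k, E (k + 1) + d k ≤ E k + e k) :
    Summable d ∧ ∃ M, ∀ k, E k ≤ M := by
  have key : ∀ n, E n + ∑ i ∈ Finset.range n, d i ≤ E 0 + ∑ i ∈ Finset.range n, e i := by
    intro n
    induction n with
    | zero => simp
    | succ n ih =>
      rw [Finset.sum_range_succ, Finset.sum_range_succ]
      linarith [h n]
  have hle : ∀ n, ∑ i ∈ Finset.range n, e i ≤ ∑' i, e i := fun n =>
    hsum.sum_le_tsum _ fun i _ => he i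
  refine ⟨summable_of_sum_range_le (c := E 0 + ∑' i, e i) hd fun n => ?_,
    E 0 + ∑' i, e i, fun n => ?_⟩
  · linarith [key n, hE n, hle n]
  · linarith [key n, hle n, Finset.sum_nonneg fun i (_ : i ∈ Finset.range n) => hd i]

variable {H U : Type*} [NormedAddCommGroup H] [InnerProductSpace ℝ H]
  [NormedAddCommGroup U] [InnerProductSpace ℝ U]

/-- A closed convex subset of a Hilbert space is weakly sequentially closed. -/
lemma Convex.mem_of_tendsto_inner [CompleteSpace U] {S : Set U} (hS : Convex ℝ S)
    (hcl : IsClosed S) {x : ℕ → U} {y : U}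
    (hx : ∀ w : U, Filter.Tendsto (fun k => ⟪w, x k⟫) Filter.atTop (nhds ⟪w, y⟫))
    (hmem : ∀ᶠ k in Filter.atTop, x k ∈ S) : y ∈ S := by
  by_contra hy
  obtain ⟨f, s, hfy, hfS⟩ := geometric_hahn_banach_point_closed hS hcl hy
  have hlim := hx ((InnerProductSpace.toDual ℝ U).symm f)
  simp only [InnerProductSpace.toDual_symm_apply] at hlim
  exact absurd (ge_of_tendsto hlim (hmem.mono fun k hk => (hfS _ hk).le)) (not_le.mpr hfy)

/-- At a saddle point of the augmented Lagrangian the linear constraint holds. -/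
lemma residual_eq_zero_of_augLag_le {K : U →L[ℝ] H} {J : U → ℝ} {Y : H} {lam : ℝ}
    {uhat : U} {vhat phat : H}
    (h : ∀ p : H, augLag K J Y lam uhat vhat p ≤ augLag K J Y lam uhat vhat phat) :
    K uhat + vhat - Y = 0 := by
  have h1 := h (phat - (K uhat + vhat - Y))
  simp only [augLag, inner_sub_left phat, real_inner_self_eq_norm_sq] at h1
  have h2 : ‖K uhat + vhat - Y‖ ^ 2 = 0 := le_antisymm (by linarith) (sq_nonneg _)
  simpa using h2

/-- A saddle point of the augmented Lagrangian minimizes the ordinary Lagrangian. -/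
lemma lagrangian_le_of_augLag_le {K : U →L[ℝ] H} {J : U → ℝ}
    (hJ : ConvexOn ℝ Set.univ J) {Y : H} {C : Set H} (hC : Convex ℝ C) {lam : ℝ}
    (hlam : 0 < lam) {uhat : U} {vhat phat : H} (hv : vhat ∈ C)
    (hr : K uhat + vhat - Y = 0)
    (h : ∀ u : U, ∀ v ∈ C, augLag K J Y lam uhat vhat phat ≤ augLag K J Y lam u v phat)
    (u : U) {v : H} (hvC : v ∈ C) :
    J uhat ≤ J u - ⟪phat, K u + v - Y⟫ := by
  set r := K u + v - Y with hrdef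
  set c := 1 / (2 * lam) * ‖r‖ ^ 2 with hc
  have hc0 : 0 ≤ c := by positivity
  have key : ∀ t : ℝ, 0 ≤ t → t ≤ 1 → t * (J uhat - J u + ⟪phat, r⟫) ≤ t ^ 2 * c := by
    intro t ht0 ht1
    have hres : K ((1 - t) • uhat + t • u) + ((1 - t) • vhat + t • v) - Y = t • r := by
      have : K ((1 - t) • uhat + t • u) + ((1 - t) • vhat + t • v) - Y
          = (1 - t) • (K uhat + vhat - Y) + t • r := by
        simp only [map_add, map_smul, hrdef]
        module
      rw [this, hr]; simp
    have h1 := h ((1 - t) • uhat + t • u) ((1 - t) • vhat + t • v)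
      (hC hv hvC (by linarith) ht0 (by ring))
    have h2 := hJ.2 (Set.mem_univ uhat) (Set.mem_univ u) (by linarith : 0 ≤ 1 - t) ht0 (by ring)
    simp only [augLag, hres, hr, norm_zero, inner_zero_right, inner_smul_right, norm_smul,
      mul_pow, Real.norm_eq_abs, sq_abs] at h1
    simp only [smul_eq_mul] at h2
    have h3 : 1 / (2 * lam) * (t ^ 2 * ‖r‖ ^ 2) = t ^ 2 * c := by rw [hc]; ring
    rw [h3] at h1
    linarith
  by_contra! hlt
  set X := J uhat - J u + ⟪phat, r⟫ with hX
  have hX0 : 0 < X := by linarith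
  have h1 := key (X / (X + c)) (by positivity) ((div_le_one (by positivity)).2 (by linarith))
  have h2 : X / (X + c) * X - (X / (X + c)) ^ 2 * c = X ^ 3 / (X + c) ^ 2 := by
    field_simp; ring
  have h3 : 0 < X ^ 3 / (X + c) ^ 2 := by positivity
  linarith

/-- The one-step energy estimate behind the convergence of ADMM. -/
lemma admm_energy_step {lam : ℝ} (hlam : 0 < lam) {p₀ p₁ q a₀ a₁ b : H} {D D' ε δ δ' : ℝ}
    (hp : p₁ = p₀ - (1 / lam) • (a₁ + b))
    (hv : -ε ≤ ⟪p₁ + (1 / lam) • (a₁ - a₀), b⟫)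
    (hu : -δ ≤ D + ⟪p₁, a₁⟫) (hq : D ≤ -⟪q, a₁ + b⟫)
    (hu₁ : -δ ≤ D' - ⟪p₁, a₀ - a₁⟫) (hu₀ : -δ' ≤ -D' - ⟪p₀, a₁ - a₀⟫) :
    (lam / 2 * ‖p₁ - q‖ ^ 2 + 1 / (2 * lam) * ‖a₁‖ ^ 2)
        + 1 / (2 * lam) * (‖a₁ + b‖ ^ 2 + ‖a₁ - a₀‖ ^ 2)
      ≤ (lam / 2 * ‖p₀ - q‖ ^ 2 + 1 / (2 * lam) * ‖a₀‖ ^ 2) + (ε + 2 * δ + δ') := by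
  obtain ⟨m, hm⟩ : ∃ m, m = 1 / lam := ⟨_, rfl⟩
  have hml : lam * m = 1 := by rw [hm]; field_simp
  have hm2 : 1 / (2 * lam) = m / 2 := by rw [hm]; field_simp
  rw [← hm] at hp hv
  rw [hm2]
  obtain rfl : p₀ = p₁ + m • (a₁ + b) := by rw [hp]; abel
  have hpq : p₁ + m • (a₁ + b) - q = (p₁ - q) + m • (a₁ + b) := by abel
  rw [hpq, norm_add_sq_real (p₁ - q)]
  simp only [← real_inner_self_eq_norm_sq, inner_add_left, inner_add_right, inner_sub_left,
    inner_sub_right, inner_smul_left, inner_smul_right, conj_trivial] at *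
  simp only [real_inner_comm a₁ b, real_inner_comm a₀ b, real_inner_comm a₁ a₀] at *
  linear_combination hv + hu + hq + hu₁ + hu₀ - (⟪p₁, a₁⟫ + ⟪p₁, b⟫ - ⟪q, a₁⟫ - ⟪q, b⟫
    + m / 2 * (⟪a₁, a₁⟫ + 2 * ⟪a₁, b⟫ + ⟪b, b⟫)) * hml

end Auxiliary

/-- Convergence of the approximate alternating direction method of multipliers
(Proposition A.2). -/
theorem admm_approximate_convergence
    {H U : Type*}
    [NormedAddCommGroup H] [InnerProductSpace ℝ H] [FiniteDimensional ℝ H]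
    [NormedAddCommGroup U] [InnerProductSpace ℝ U] [CompleteSpace U]
    (K : U →L[ℝ] H) (J : U → ℝ)
    (hJconv : ConvexOn ℝ Set.univ J) (hJlsc : LowerSemicontinuous J)
    (Y : H) (C : Set H) (hCne : C.Nonempty) (hCclosed : IsClosed C)
    (hCconv : Convex ℝ C)
    (lam : ℝ) (hlam : 0 < lam)
    -- saddle point of the augmented Lagrangian
    (uhat : U) (vhat phat : H) (hvhatC : vhat ∈ C)
    (hsaddle₁ : ∀ p : H, augLag K J Y lam uhat vhat p ≤ augLag K J Y lam uhat vhat phat)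
    (hsaddle₂ : ∀ u : U, ∀ v ∈ C, augLag K J Y lam uhat vhat phat ≤ augLag K J Y lam u v phat)
    -- coercivity-type assumption
    (hbdd : ∀ a b : ℝ, Bornology.IsBounded {w : U | ‖K w‖ ≤ a ∧ J w ≤ b})
    -- approximate ADMM sequence with tolerances ε, δ
    (u : ℕ → U) (v p : ℕ → H) (ε δ : ℕ → ℝ)
    (hε : ∀ k, 1 ≤ k → 0 ≤ ε k) (hδ : ∀ k, 0 ≤ δ k) (hδ0 : δ 0 = 0)
    (hu0 : u 0 = 0) (hv0 : v 0 = 0) (hp0 : p 0 = 0)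
    (hstep1 : ∀ k, 1 ≤ k → v k ∈ C ∧ ∀ w ∈ C,
      (1 / lam) * ⟪K (u (k - 1)) + v k - Y - lam • p (k - 1), w - v k⟫ ≥ -ε k)
    (hstep2 : ∀ k, 1 ≤ k → ∀ w : U,
      J w - J (u k) + (1 / lam) * ⟪K (u k) + v k - Y - lam • p (k - 1), K w - K (u k)⟫ ≥ -δ k)
    (hstep3 : ∀ k, 1 ≤ k → p k = p (k - 1) - (1 / lam) • (K (u k) + v k - Y))
    -- summable tolerances
    (hD : Summable (fun k : ℕ => δ (k + 1)))
    (hE : Summable (fun k : ℕ => ε (k + 1))) :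
    -- (a) boundedness of the sequence (u_k, v_k)_{k ≥ 1}
    Bornology.IsBounded (Set.range (fun k : ℕ => (u (k + 1), v (k + 1)))) ∧
    -- (b) square-summability of the residuals
    Summable (fun k : ℕ => ‖K (u (k + 1)) + v (k + 1) - Y‖ ^ 2 +
        ‖K (u (k + 1)) - K (u k)‖ ^ 2) ∧
    -- (c) every weak cluster point solves the constrained problem
    (∀ φ : ℕ → ℕ, StrictMono φ → ∀ (ut : U) (vt : H),
      (∀ w : U, Filter.Tendsto (fun k : ℕ => ⟪w, u (φ k)⟫) Filter.atTop (nhds ⟪w, ut⟫)) →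
      Filter.Tendsto (fun k : ℕ => v (φ k)) Filter.atTop (nhds vt) →
      vt ∈ C ∧ K ut + vt = Y ∧ ∀ w : U, Y - K w ∈ C → J ut ≤ J w) := by
  have hr := residual_eq_zero_of_augLag_le hsaddle₁
  have hlag : ∀ u : U, ∀ v ∈ C, J uhat ≤ J u - ⟪phat, K u + v - Y⟫ := fun u v hv =>
    lagrangian_le_of_augLag_le hJconv hCconv hlam hvhatC hr hsaddle₂ u hv
  have hlam' : 0 < 1 / lam := by positivity
  have hvC : ∀ k, v (k + 1) ∈ C := fun k => (hstep1 (k + 1) (by omega)).1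
  have hp : ∀ k, p (k + 1) = p k - (1 / lam) • (K (u (k + 1)) + v (k + 1) - Y) := fun k =>
    hstep3 (k + 1) (by omega)
  have hsplit : ∀ k, K (u (k + 1)) - K uhat + (v (k + 1) - vhat)
      = K (u (k + 1)) + v (k + 1) - Y := fun k => by
    rw [← sub_zero (K (u (k + 1)) + v (k + 1) - Y), ← hr]; abel
  have hvstep : ∀ k, ∀ w ∈ C, -ε (k + 1) ≤
      -⟪p (k + 1) + (1 / lam) • (K (u (k + 1)) - K (u k)), w - v (k + 1)⟫ := by
    intro k w hw
    have h := (hstep1 (k + 1) (by omega)).2 w hw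
    rw [Nat.add_sub_cancel, ge_iff_le, ← real_inner_smul_left] at h
    rw [← inner_neg_left]
    convert h using 2
    rw [hp k]
    simp only [smul_sub, smul_add, smul_smul, one_div_mul_cancel hlam.ne', one_smul]
    abel
  have hustep : ∀ k, ∀ w : U, -δ (k + 1) ≤
      J w - J (u (k + 1)) - ⟪p (k + 1), K w - K (u (k + 1))⟫ := by
    intro k w
    have h := hstep2 (k + 1) (by omega) w
    rw [Nat.add_sub_cancel, ge_iff_le, ← real_inner_smul_left] at h
    rw [sub_eq_add_neg (J w - _), ← inner_neg_left]
    convert h using 3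
    rw [hp k]
    simp only [smul_sub, smul_add, smul_smul, one_div_mul_cancel hlam.ne', one_smul]
    abel
  -- energy estimate from the second step on
  have henergy : ∀ k,
      (lam / 2 * ‖p (k + 1 + 1) - phat‖ ^ 2
          + 1 / (2 * lam) * ‖K (u (k + 1 + 1)) - K uhat‖ ^ 2)
        + 1 / (2 * lam) * (‖K (u (k + 1 + 1)) + v (k + 1 + 1) - Y‖ ^ 2
            + ‖K (u (k + 1 + 1)) - K (u (k + 1))‖ ^ 2)
      ≤ (lam / 2 * ‖p (k + 1) - phat‖ ^ 2 + 1 / (2 * lam) * ‖K (u (k + 1)) - K uhat‖ ^ 2)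
        + (ε (k + 1 + 1) + 2 * δ (k + 1 + 1) + δ (k + 1)) := by
    intro k
    have hd : K (u (k + 1 + 1)) - K uhat - (K (u (k + 1)) - K uhat)
        = K (u (k + 1 + 1)) - K (u (k + 1)) := by abel
    have hd' : K (u (k + 1)) - K uhat - (K (u (k + 1 + 1)) - K uhat)
        = K (u (k + 1)) - K (u (k + 1 + 1)) := by abel
    have h := admm_energy_step hlam (p₀ := p (k + 1)) (p₁ := p (k + 1 + 1)) (q := phat)
      (a₀ := K (u (k + 1)) - K uhat) (a₁ := K (u (k + 1 + 1)) - K uhat)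
      (b := v (k + 1 + 1) - vhat) (D := J uhat - J (u (k + 1 + 1)))
      (D' := J (u (k + 1)) - J (u (k + 1 + 1))) (ε := ε (k + 1 + 1)) (δ := δ (k + 1 + 1))
      (δ' := δ (k + 1))
    rw [hsplit, hd, hd'] at h
    refine h (hp (k + 1)) ?_ ?_ ?_ (hustep (k + 1) (u (k + 1))) ?_
    · have := hvstep (k + 1) vhat hvhatC
      rwa [← inner_neg_right, neg_sub] at this
    · have := hustep (k + 1) uhat
      rwa [sub_eq_add_neg (J uhat - _), ← inner_neg_right, neg_sub] at this
    · linarith [hlag (u (k + 1 + 1)) _ (hvC (k + 1))]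
    · linarith [hustep k (u (k + 1 + 1))]
  have herr : Summable fun k => ε (k + 1 + 1) + 2 * δ (k + 1 + 1) + δ (k + 1) :=
    (((summable_nat_add_iff 1).2 hE).add (((summable_nat_add_iff 1).2 hD).mul_left 2)).add hD
  obtain ⟨hdsum, M, hM⟩ := summable_and_bounded_of_quasi_descent
    (E := fun k => lam / 2 * ‖p (k + 1) - phat‖ ^ 2
      + 1 / (2 * lam) * ‖K (u (k + 1)) - K uhat‖ ^ 2)
    (fun k => by positivity) (fun k => by positivity)
    (fun k => by linarith [hε (k + 1 + 1) (by omega), hδ (k + 1 + 1), hδ (k + 1)])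
    herr henergy
  have hsum : Summable (fun k : ℕ => ‖K (u (k + 1)) + v (k + 1) - Y‖ ^ 2 +
      ‖K (u (k + 1)) - K (u k)‖ ^ 2) := by
    refine (summable_nat_add_iff 1).1 ((summable_mul_left_iff ?_).1 hdsum)
    positivity
  obtain ⟨P, hP0, hP⟩ : ∃ P, 0 ≤ P ∧ ∀ k, ‖p k‖ ≤ P := by
    refine ⟨√(M / (lam / 2)) + ‖phat‖, by positivity, fun k => ?_⟩
    rcases k with _ | k
    · rw [hp0, norm_zero]; positivity
    · have h1 : ‖p (k + 1) - phat‖ ≤ √(M / (lam / 2)) := by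
        refine Real.le_sqrt_of_sq_le ((le_div_iff₀' (by positivity)).2 ?_)
        have : 0 ≤ 1 / (2 * lam) * ‖K (u (k + 1)) - K uhat‖ ^ 2 := by positivity
        linarith [hM k]
      linarith [norm_le_norm_sub_add (p (k + 1)) phat]
  obtain ⟨A, hA⟩ : ∃ A, ∀ k, ‖K (u (k + 1)) - K uhat‖ ≤ A := by
    refine ⟨√(M / (1 / (2 * lam))), fun k => ?_⟩
    refine Real.le_sqrt_of_sq_le ((le_div_iff₀' (by positivity)).2 ?_)
    have : 0 ≤ lam / 2 * ‖p (k + 1) - phat‖ ^ 2 := by positivity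
    linarith [hM k]
  have hR : ∀ k, ‖K (u (k + 1)) + v (k + 1) - Y‖ ≤ lam * (P + P) := fun k => by
    have h1 : K (u (k + 1)) + v (k + 1) - Y = lam • (p k - p (k + 1)) := by
      rw [hp k, sub_sub_cancel, smul_smul, mul_one_div_cancel hlam.ne', one_smul]
    rw [h1, norm_smul, Real.norm_of_nonneg hlam.le]
    gcongr
    exact (norm_sub_le _ _).trans (add_le_add (hP _) (hP _))
  have hV : ∀ k, ‖v (k + 1)‖ ≤ lam * (P + P) + A + ‖vhat‖ := fun k => by
    have h1 : v (k + 1) = (K (u (k + 1)) + v (k + 1) - Y) - (K (u (k + 1)) - K uhat) + vhat := by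
      rw [← hsplit]; abel
    rw [h1]
    exact (norm_add_le _ _).trans
      (add_le_add_left ((norm_sub_le _ _).trans (add_le_add (hR k) (hA k))) _)
  refine ⟨?_, hsum, ?_⟩
  · have hUb := hbdd (A + ‖K uhat‖) (J uhat + P * A + ∑' k, δ (k + 1))
    have hVb := Metric.isBounded_closedBall (x := (0 : H)) (r := lam * (P + P) + A + ‖vhat‖)
    refine (hUb.prod hVb).subset ?_
    rintro _ ⟨k, rfl⟩
    refine ⟨⟨?_, ?_⟩, by simpa using hV k⟩
    · linarith [norm_le_norm_sub_add (K (u (k + 1))) (K uhat), hA k]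
    · have h1 : -⟪p (k + 1), K uhat - K (u (k + 1))⟫ ≤ P * A := by
        rw [← inner_neg_right, neg_sub]
        exact (real_inner_le_norm _ _).trans
          (mul_le_mul (hP _) (hA _) (norm_nonneg _) hP0)
      have h2 : δ (k + 1) ≤ ∑' k, δ (k + 1) := hD.le_tsum k fun j _ => hδ (j + 1)
      simp only
      linarith [hustep k uhat]
  have hshift : ∀ {Q : ℕ → Prop}, (∀ᶠ k in Filter.atTop, Q (k + 1)) →
      ∀ᶠ k in Filter.atTop, Q k := fun h => by
    rw [← Filter.map_add_atTop_eq_nat 1]; exact h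
  have hr0 : Filter.Tendsto (fun k => ‖K (u (k + 1)) + v (k + 1) - Y‖) Filter.atTop (nhds 0) := by
    have h := (hsum.of_nonneg_of_le (fun k => sq_nonneg _)
      (fun k => le_add_of_nonneg_right (sq_nonneg _))).tendsto_atTop_zero.sqrt
    simpa [Real.sqrt_sq] using h
  have hd0 : Filter.Tendsto (fun k => ‖K (u (k + 1)) - K (u k)‖) Filter.atTop (nhds 0) := by
    have h := (hsum.of_nonneg_of_le (fun k => sq_nonneg _)
      (fun k => le_add_of_nonneg_left (sq_nonneg _))).tendsto_atTop_zero.sqrt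
    simpa [Real.sqrt_sq] using h
  intro φ hφ ut vt hut hvt
  have hφt := hφ.tendsto_atTop
  refine ⟨?_, ?_, ?_⟩
  · exact hCclosed.mem_of_tendsto hvt (hφt.eventually (hshift (Q := fun k => v k ∈ C) (.of_forall hvC)))
  · have : CompleteSpace H := FiniteDimensional.complete ℝ H
    have h1 : Filter.Tendsto (fun k => K (u (φ k)) + v (φ k) - Y) Filter.atTop (nhds 0) :=
      ((Filter.tendsto_add_atTop_iff_nat (f := fun k => K (u k) + v k - Y) 1).1
        (tendsto_zero_iff_norm_tendsto_zero.2 hr0)).comp hφt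
    refine eq_of_sub_eq_zero (ext_inner_left ℝ fun w => ?_)
    refine tendsto_nhds_unique (f := fun k => ⟪w, K (u (φ k)) + v (φ k) - Y⟫) (l := Filter.atTop)
      ?_ (by simpa using tendsto_const_nhds.inner h1)
    simp only [inner_sub_right, inner_add_right]
    have h2 := hut (ContinuousLinearMap.adjoint K w)
    simp only [ContinuousLinearMap.adjoint_inner_left] at h2
    exact (h2.add (tendsto_const_nhds.inner hvt)).sub_const _
  · intro w hw
    set B := ‖Y - K w‖ + (lam * (P + P) + A + ‖vhat‖)
    have hgap : ∀ k, J (u (k + 1)) ≤ J w + (P * ‖K (u (k + 1)) + v (k + 1) - Y‖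
        + 1 / lam * ‖K (u (k + 1)) - K (u k)‖ * B + δ (k + 1) + ε (k + 1)) := by
      intro k
      have h1 := hustep k w
      have h2 := hvstep k _ hw
      have h4 : ⟪p (k + 1), K (u (k + 1)) + v (k + 1) - Y⟫
          ≤ P * ‖K (u (k + 1)) + v (k + 1) - Y‖ :=
        (real_inner_le_norm _ _).trans (by gcongr; exact hP _)
      have h5 : -⟪(1 / lam) • (K (u (k + 1)) - K (u k)), Y - K w - v (k + 1)⟫
          ≤ 1 / lam * ‖K (u (k + 1)) - K (u k)‖ * B := by
        rw [← inner_neg_left]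
        refine (real_inner_le_norm _ _).trans ?_
        rw [norm_neg, norm_smul, Real.norm_of_nonneg hlam'.le]
        gcongr
        exact (norm_sub_le _ _).trans (add_le_add_right (hV k) _)
      have h3 : K w - K (u (k + 1)) =
          -(Y - K w - v (k + 1)) - (K (u (k + 1)) + v (k + 1) - Y) := by abel
      rw [h3, inner_sub_right, inner_neg_right] at h1
      rw [inner_add_left] at h2
      linarith
    have hlim : Filter.Tendsto (fun k => J w + (P * ‖K (u (k + 1)) + v (k + 1) - Y‖
        + 1 / lam * ‖K (u (k + 1)) - K (u k)‖ * B + δ (k + 1) + ε (k + 1)))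
        Filter.atTop (nhds (J w)) := by
      simpa using ((((hr0.const_mul P).add ((hd0.const_mul (1 / lam)).mul_const B)).add
        hD.tendsto_atTop_zero).add hE.tendsto_atTop_zero).const_add (J w)
    refine le_of_forall_gt_imp_ge_of_dense fun c hc => ?_
    have hmem : ut ∈ {x : U | x ∈ Set.univ ∧ J x ≤ c} := by
      refine (hJconv.convex_le c).mem_of_tendsto_inner ?_ hut
        (hφt.eventually (hshift (Q := fun k => u k ∈ {x : U | x ∈ Set.univ ∧ J x ≤ c}) ?_))
      · simpa [Set.preimage, Set.Iic] using hJlsc.isClosed_preimage c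
      · filter_upwards [hlim.eventually (gt_mem_nhds hc)] with k hk
        exact ⟨Set.mem_univ _, (hgap k).trans hk.le⟩
    exact hmem.2
end

section
/- Rate of order √τ for quadratic regularization (Corollary 2.4): under the stated setting, let V be a further real Hilbert space, L : U → V a bounded linear operator, and J(u) = (1/2)‖L u‖²_V. Let (û, v̂, p̂) be a saddle point of L_λ and let (u_k, v_k, p_k)_{k≥0} be an exact ADMM sequence. Let τ > 0 and let k ≥ 1 be an index with ‖K u_k + v_k − Y‖ ≤ τ and ‖K(u_k − u_{k−1})‖ ≤ τ. Then (1/2)‖L(u_k − û)‖²_V ≤ τ·(6‖p̂‖ + (4‖K û‖ + 2τ)/λ); in particular ‖L(u_k − û)‖_V = O(√τ) as τ → 0. -/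
open RealInnerProductSpace

theorem nonneg_of_forall_mul_add_sq_mul_nonneg {a c : ℝ}
    (h : ∀ t : ℝ, 0 < t → t ≤ 1 → 0 ≤ t * a + t ^ 2 * c) : 0 ≤ a := by
  by_contra! ha
  have hc : 0 < |c| + |a| := add_pos_of_nonneg_of_pos (abs_nonneg c) (abs_pos.2 ha.ne)
  have hpos : 0 < -a / (2 * (|c| + |a|)) := div_pos (by linarith) (by linarith)
  have hle : -a / (2 * (|c| + |a|)) ≤ 1 := by
    rw [div_le_one (by linarith)]
    linarith [neg_abs_le a, abs_nonneg c, abs_nonneg a]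
  have hmul : -a / (2 * (|c| + |a|)) * (2 * (|c| + |a|)) = -a :=
    div_mul_cancel₀ _ (by linarith)
  have ht := h _ hpos hle
  set t := -a / (2 * (|c| + |a|))
  have hfac : 0 ≤ a + t * c := nonneg_of_mul_nonneg_right (by linarith) hpos
  nlinarith [le_abs_self c, abs_nonneg a]

section Quadratic

variable {U V : Type*} [NormedAddCommGroup U] [InnerProductSpace ℝ U]
  [NormedAddCommGroup V] [InnerProductSpace ℝ V]

theorem half_norm_sq_map_add_smul (L : U →L[ℝ] V) (x d : U) (t : ℝ) :
    (1 / 2) * ‖L (x + t • d)‖ ^ 2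
      = (1 / 2) * ‖L x‖ ^ 2 + t * ⟪L x, L d⟫ + t ^ 2 * ((1 / 2) * ‖L d‖ ^ 2) := by
  rw [map_add, map_smul, norm_add_sq_real, inner_smul_right, norm_smul, mul_pow,
    Real.norm_eq_abs, sq_abs]
  ring

/-- A minimizer of a quadratic perturbation of `½‖L ·‖² - f` satisfies the strong subgradient
inequality for `½‖L ·‖²` with subgradient `f`. -/
theorem half_norm_sq_map_sub_le_of_minimizer (L : U →L[ℝ] V) (f : U →ₗ[ℝ] ℝ)
    (q : U → ℝ) (hq : ∀ (t : ℝ) (d : U), q (t • d) = t ^ 2 * q d) (x : U)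
    (h : ∀ w, (1 / 2) * ‖L x‖ ^ 2 + f (w - x) ≤ (1 / 2) * ‖L w‖ ^ 2 + q (w - x)) (w : U) :
    (1 / 2) * ‖L (w - x)‖ ^ 2 + f (w - x) ≤ (1 / 2) * ‖L w‖ ^ 2 - (1 / 2) * ‖L x‖ ^ 2 := by
  have hslope : 0 ≤ ⟪L x, L (w - x)⟫ - f (w - x) := by
    refine nonneg_of_forall_mul_add_sq_mul_nonneg
      (c := (1 / 2) * ‖L (w - x)‖ ^ 2 + q (w - x)) fun t _ _ => ?_
    have := h (x + t • (w - x))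
    rw [half_norm_sq_map_add_smul, add_sub_cancel_left, map_smul, hq, smul_eq_mul] at this
    linarith
  have hexp := half_norm_sq_map_add_smul L x (w - x) 1
  rw [one_smul, add_sub_cancel] at hexp
  linarith

end Quadratic

section SaddlePoint

variable {H U : Type*} [NormedAddCommGroup H] [InnerProductSpace ℝ H]
  [NormedAddCommGroup U] [InnerProductSpace ℝ U]
  {K : U →L[ℝ] H} {J : U → ℝ} {Y : H} {C : Set H} {lam : ℝ} {uhat : U} {vhat phat : H}

theorem feasible_of_augLag_le
    (h : ∀ p : H, augLag K J Y lam uhat vhat p ≤ augLag K J Y lam uhat vhat phat) :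
    K uhat + vhat - Y = 0 := by
  have := h (phat - (K uhat + vhat - Y))
  rw [augLag, augLag, inner_sub_left phat, real_inner_self_eq_norm_sq] at this
  rw [← norm_eq_zero, ← sq_eq_zero_iff]
  exact le_antisymm (by linarith) (sq_nonneg _)

theorem inner_sub_nonpos_of_augLag_le (hC : Convex ℝ C) (hv : vhat ∈ C)
    (hfeas : K uhat + vhat - Y = 0)
    (h : ∀ u : U, ∀ v ∈ C, augLag K J Y lam uhat vhat phat ≤ augLag K J Y lam u v phat)
    {w : H} (hw : w ∈ C) : ⟪phat, w - vhat⟫ ≤ 0 := by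
  rw [← neg_nonneg]
  refine nonneg_of_forall_mul_add_sq_mul_nonneg
    (c := (1 / (2 * lam)) * ‖w - vhat‖ ^ 2) fun t ht₀ ht₁ => ?_
  have := h uhat _ (hC.add_smul_sub_mem hv hw ⟨ht₀.le, ht₁⟩)
  have hres : K uhat + (vhat + t • (w - vhat)) - Y = t • (w - vhat) := by
    rw [← add_assoc, add_sub_right_comm, hfeas, zero_add]
  simp only [augLag, hres, hfeas, inner_smul_right, norm_smul, mul_pow, Real.norm_eq_abs,
    sq_abs, norm_zero, inner_zero_right] at this
  linarith

theorem half_norm_sq_add_inner_le_of_augLag_le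
    {V : Type*} [NormedAddCommGroup V] [InnerProductSpace ℝ V] {L : U →L[ℝ] V}
    (hJ : ∀ w : U, J w = (1 / 2) * ‖L w‖ ^ 2) (hv : vhat ∈ C)
    (hfeas : K uhat + vhat - Y = 0)
    (h : ∀ u : U, ∀ v ∈ C, augLag K J Y lam uhat vhat phat ≤ augLag K J Y lam u v phat)
    (w : U) :
    (1 / 2) * ‖L (w - uhat)‖ ^ 2 + ⟪phat, K w - K uhat⟫ ≤ J w - J uhat := by
  have := half_norm_sq_map_sub_le_of_minimizer L ((innerSL ℝ phat ∘L K : U →L[ℝ] ℝ) : U →ₗ[ℝ] ℝ)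
    (fun d => (1 / (2 * lam)) * ‖K d‖ ^ 2)
    (fun t d => by simp only [map_smul, norm_smul, mul_pow, Real.norm_eq_abs, sq_abs]; ring)
    uhat (fun w => by
      have hw := h w vhat hv
      have hres : K w + vhat - Y = K (w - uhat) := by
        rw [map_sub, ← sub_zero (K w + vhat - Y), ← hfeas]
        abel
      simp only [augLag, hres, hfeas, hJ, norm_zero, inner_zero_right] at hw
      simp only [ContinuousLinearMap.coe_coe, ContinuousLinearMap.comp_apply, innerSL_apply_apply]
      linarith) w
  simpa only [ContinuousLinearMap.coe_coe, ContinuousLinearMap.comp_apply, innerSL_apply_apply,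
    map_sub K, hJ] using this

end SaddlePoint

section Fejer

variable {H : Type*} [NormedAddCommGroup H] [InnerProductSpace ℝ H]

/-- Fejér monotonicity of one ADMM step, in terms of the errors `e = p_k - p̂`, `b = K u_k - K û`
and their predecessors `e'`, `b'`. -/
theorem admm_error_sq_le {lam : ℝ} (hlam : 0 < lam) {e e' b b' r : H}
    (hr : r = lam • (e' - e)) (hmono : 0 ≤ ⟪e - e', b - b'⟫)
    (h : 0 ≤ ⟪e, r⟫ + (1 / lam) * ⟪b - b', r - b⟫) :
    lam ^ 2 * ‖e‖ ^ 2 + ‖b‖ ^ 2 ≤ lam ^ 2 * ‖e'‖ ^ 2 + ‖b'‖ ^ 2 := by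
  have he := norm_sub_sq_real e e'
  have hb := norm_sub_sq_real b b'
  have h' : 0 ≤ lam * (⟪e, r⟫ + (1 / lam) * ⟪b - b', r - b⟫) := mul_nonneg hlam.le h
  have hl : lam * (1 / lam) = 1 := mul_one_div_cancel hlam.ne'
  rw [mul_add, ← mul_assoc, hl, one_mul, hr, inner_sub_right, inner_smul_right, inner_smul_right,
    inner_sub_right, real_inner_self_eq_norm_sq, inner_sub_left b b' b, real_inner_self_eq_norm_sq,
    real_inner_comm b b', real_inner_comm _ (b - b'),
    ← neg_sub e e', inner_neg_left] at h'
  have hm := mul_nonneg hlam.le hmono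
  have hq := mul_nonneg (sq_nonneg lam) (sq_nonneg ‖e - e'‖)
  rw [he] at hq
  nlinarith [sq_nonneg ‖b - b'‖]

end Fejer

/-- Rate of order `√τ` for quadratic regularization (Corollary 2.4). -/
theorem admm_quadratic_rate
    {H U V : Type*}
    [NormedAddCommGroup H] [InnerProductSpace ℝ H] [FiniteDimensional ℝ H]
    [NormedAddCommGroup U] [InnerProductSpace ℝ U] [CompleteSpace U]
    [NormedAddCommGroup V] [InnerProductSpace ℝ V] [CompleteSpace V]
    (K : U →L[ℝ] H) (L : U →L[ℝ] V) (J : U → ℝ)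
    (hJ : ∀ w : U, J w = (1 / 2) * ‖L w‖ ^ 2)
    (Y : H) (C : Set H) (hCne : C.Nonempty) (hCclosed : IsClosed C)
    (hCconv : Convex ℝ C)
    (lam : ℝ) (hlam : 0 < lam)
    -- saddle point of the augmented Lagrangian
    (uhat : U) (vhat phat : H) (hvhatC : vhat ∈ C)
    (hsaddle₁ : ∀ p : H, augLag K J Y lam uhat vhat p ≤ augLag K J Y lam uhat vhat phat)
    (hsaddle₂ : ∀ u : U, ∀ v ∈ C, augLag K J Y lam uhat vhat phat ≤ augLag K J Y lam u v phat)
    -- exact ADMM sequence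
    (u : ℕ → U) (v p : ℕ → H)
    (hu0 : u 0 = 0) (hv0 : v 0 = 0) (hp0 : p 0 = 0)
    (hstep1 : ∀ k, 1 ≤ k → v k ∈ C ∧ ∀ w ∈ C,
      (1 / lam) * ⟪K (u (k - 1)) + v k - Y - lam • p (k - 1), w - v k⟫ ≥ 0)
    (hstep2 : ∀ k, 1 ≤ k → ∀ w : U,
      J w - J (u k) + (1 / lam) * ⟪K (u k) + v k - Y - lam • p (k - 1), K w - K (u k)⟫ ≥ 0)
    (hstep3 : ∀ k, 1 ≤ k → p k = p (k - 1) - (1 / lam) • (K (u k) + v k - Y))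
    -- stopping index
    (τ : ℝ) (hτ : 0 < τ) (k : ℕ) (hk : 1 ≤ k)
    (hres1 : ‖K (u k) + v k - Y‖ ≤ τ)
    (hres2 : ‖K (u k) - K (u (k - 1))‖ ≤ τ) :
    (1 / 2) * ‖L (u k - uhat)‖ ^ 2 ≤
      τ * (6 * ‖phat‖ + (4 * ‖K uhat‖ + 2 * τ) / lam) := by
  have hfeas := feasible_of_augLag_le hsaddle₁
  have hsub : ∀ j w, ⟪p j, K w - K (u j)⟫ ≤ J w - J (u j) := by
    intro j w
    rcases Nat.eq_zero_or_pos j with rfl | hj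
    · rw [hp0, hu0, inner_zero_left, hJ, hJ, map_zero, norm_zero]
      nlinarith [sq_nonneg ‖L w‖]
    · have h := hstep2 j hj w
      have hp : p j = -(1 / lam) • (K (u j) + v j - Y - lam • p (j - 1)) := by
        rw [hstep3 j hj, smul_sub _ _ (lam • _), smul_smul, neg_mul, one_div_mul_cancel hlam.ne']
        module
      rw [hp, inner_smul_left]
      simp only [conj_trivial]
      linarith
  have key : ∀ j, 1 ≤ j → (1 / 2) * ‖L (u j - uhat)‖ ^ 2 ≤
      ⟪p j - phat, K (u j) + v j - Y⟫
        + (1 / lam) * ⟪K (u j) - K (u (j - 1)), v j - vhat⟫ := by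
    intro j hj
    obtain ⟨hvC, hvar⟩ := hstep1 j hj
    have h₁ := hvar vhat hvhatC
    have h₂ := inner_sub_nonpos_of_augLag_le hCconv hvhatC hfeas hsaddle₂ hvC
    have h₃ := half_norm_sq_add_inner_le_of_augLag_le hJ hvhatC hfeas hsaddle₂ (u j)
    have h₄ := hsub j uhat
    have hpj : K (u (j - 1)) + v j - Y - lam • p (j - 1)
        = -(lam • p j) - (K (u j) - K (u (j - 1))) := by
      rw [hstep3 j hj, smul_sub, smul_smul, mul_one_div_cancel hlam.ne']
      module
    have hres : K (u j) + v j - Y = (K (u j) - K uhat) + (v j - vhat) := by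
      rw [← sub_zero (K (u j) + v j - Y), ← hfeas]
      abel
    rw [hpj, ← neg_sub (v j) vhat, inner_neg_right, inner_sub_left, inner_neg_left,
      inner_smul_left, conj_trivial] at h₁
    rw [← neg_sub (K (u j)) (K uhat), inner_neg_right] at h₄
    rw [hres, inner_add_right, inner_sub_left, inner_sub_left]
    have hl : 1 / lam * (lam * ⟪p j, v j - vhat⟫) = ⟪p j, v j - vhat⟫ := by
      field_simp
    nlinarith
  have hstep : ∀ j, lam ^ 2 * ‖p (j + 1) - phat‖ ^ 2 + ‖K (u (j + 1)) - K uhat‖ ^ 2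
      ≤ lam ^ 2 * ‖p j - phat‖ ^ 2 + ‖K (u j) - K uhat‖ ^ 2 := by
    intro j
    refine admm_error_sq_le hlam (r := K (u (j + 1)) + v (j + 1) - Y) ?_ ?_ ?_
    · rw [hstep3 (j + 1) (by omega), Nat.add_sub_cancel, sub_sub_sub_cancel_right, sub_sub_cancel,
        smul_smul, mul_one_div_cancel hlam.ne', one_smul]
    · have h₁ := hsub j (u (j + 1))
      have h₂ := hsub (j + 1) (u j)
      rw [sub_sub_sub_cancel_right, sub_sub_sub_cancel_right, inner_sub_left]
      rw [← neg_sub, inner_neg_right] at h₂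
      linarith
    · have h := key (j + 1) (by omega)
      have hv : K (u (j + 1)) + v (j + 1) - Y - (K (u (j + 1)) - K uhat) = v (j + 1) - vhat := by
        rw [← sub_zero (K (u (j + 1)) + v (j + 1) - Y), ← hfeas]
        abel
      rw [Nat.add_sub_cancel] at h
      rw [hv, sub_sub_sub_cancel_right]
      exact le_trans (by positivity) h
  have hfejer : ∀ j, lam ^ 2 * ‖p j - phat‖ ^ 2 + ‖K (u j) - K uhat‖ ^ 2
      ≤ lam ^ 2 * ‖phat‖ ^ 2 + ‖K uhat‖ ^ 2 := by
    intro j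
    induction j with
    | zero => simp [hp0, hu0]
    | succ j ih => exact (hstep j).trans ih
  have hk' := hfejer k
  have hsum : lam ^ 2 * ‖phat‖ ^ 2 + ‖K uhat‖ ^ 2 ≤ (lam * ‖phat‖ + ‖K uhat‖) ^ 2 := by
    have : 0 ≤ lam * ‖phat‖ * ‖K uhat‖ := by positivity
    linarith
  have hpk : lam * ‖p k - phat‖ ≤ lam * ‖phat‖ + ‖K uhat‖ :=
    le_of_sq_le_sq (by nlinarith [sq_nonneg ‖K (u k) - K uhat‖]) (by positivity)
  have hak : ‖K (u k) - K uhat‖ ≤ lam * ‖phat‖ + ‖K uhat‖ :=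
    le_of_sq_le_sq (by nlinarith [sq_nonneg (lam * ‖p k - phat‖)]) (by positivity)
  have hvk : ‖v k - vhat‖ ≤ τ + (lam * ‖phat‖ + ‖K uhat‖) := by
    have : v k - vhat = (K (u k) + v k - Y) - (K (u k) - K uhat) := by
      rw [← sub_zero (K (u k) + v k - Y), ← hfeas]
      abel
    rw [this]
    exact (norm_sub_le _ _).trans (add_le_add hres1 hak)
  have h₁ : ⟪p k - phat, K (u k) + v k - Y⟫ ≤ ‖p k - phat‖ * τ :=
    (real_inner_le_norm _ _).trans (by gcongr)
  have h₂ : ⟪K (u k) - K (u (k - 1)), v k - vhat⟫ ≤ τ * (τ + (lam * ‖phat‖ + ‖K uhat‖)) :=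
    (real_inner_le_norm _ _).trans (by gcongr)
  calc (1 / 2) * ‖L (u k - uhat)‖ ^ 2
      ≤ ‖p k - phat‖ * τ + (1 / lam) * (τ * (τ + (lam * ‖phat‖ + ‖K uhat‖))) :=
        (key k hk).trans (by gcongr)
    _ = τ * ((lam * ‖p k - phat‖ + (τ + (lam * ‖phat‖ + ‖K uhat‖))) / lam) := by
        field_simp
    _ ≤ τ * ((6 * (lam * ‖phat‖) + (4 * ‖K uhat‖ + 2 * τ)) / lam) := by
        have : 0 ≤ lam * ‖phat‖ := by positivity
        gcongr ?_ * (?_ / _)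
        linarith [norm_nonneg (K uhat)]
    _ = τ * (6 * ‖phat‖ + (4 * ‖K uhat‖ + 2 * τ) / lam) := by
        field_simp
end
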